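/- arXiv:2107.07993 — 2 statements merged into one kernel-verified Lean document; each statement's English description precedes it below -/
import Mathlib

section
/- Let 𝒞 be a category with a distinguished subcategory and an initial object 0 such that 0 → X is distinguished for every X, and let H = {H_i}_{i∈ℤ} be a relative homology on 𝒞 with values in an abelian category 𝒜 satisfying excision with respect to a collection Ξ of excisive squares. Then for every excisive square ε : (Y,Z) → (W,X) in Ξ there is a long exact Mayer–Vietoris sequence ⋯ → H_i(Z) → H_i(Y) ⊕ H_i(X) → H_i(W) → H_{i-1}(Z) → ⋯ (whose maps are induced by the morphisms of the square, the excision isomorphisms and the connecting morphisms of the pairs (Y,Z) and (W,X)), and this sequence is natural with respect to morphisms of excisive squares. -/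
open CategoryTheory Limits

universe u v w t

/-- A distinguished subcategory: a class of morphisms containing identities and
closed under composition. -/
structure DistCat (C : Type u) [Category.{v} C] : Type (max u v) where
  dist : ∀ ⦃X Y : C⦄, (X ⟶ Y) → Prop
  id_mem : ∀ X : C, dist (𝟙 X)
  comp_mem : ∀ ⦃X Y Z : C⦄ (f : X ⟶ Y) (g : Y ⟶ Z), dist f → dist g → dist (f ≫ g)

variable {C : Type u} [Category.{v} C]

/-- The category of pairs `(X, Y)`, i.e. distinguished morphisms `Y ⟶ X`. -/
structure DPair (D : DistCat C) : Type (max u v) where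
  X : C
  Y : C
  f : Y ⟶ X
  hf : D.dist f

/-- Morphisms of pairs: commutative squares. -/
@[ext]
structure DPairHom {D : DistCat C} (P Q : DPair D) : Type v where
  a : P.X ⟶ Q.X
  b : P.Y ⟶ Q.Y
  comm : b ≫ Q.f = P.f ≫ a

instance (D : DistCat C) : Category (DPair D) where
  Hom := DPairHom
  id P := ⟨𝟙 P.X, 𝟙 P.Y, by simp⟩
  comp φ ψ := ⟨φ.a ≫ ψ.a, φ.b ≫ ψ.b, by
    rw [Category.assoc, ψ.comm, ← Category.assoc, φ.comm, Category.assoc]⟩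
  id_comp φ := by apply DPairHom.ext <;> simp
  comp_id φ := by apply DPairHom.ext <;> simp
  assoc φ ψ χ := by apply DPairHom.ext <;> simp

variable {D : DistCat C}

/-- Helper to build morphisms of pairs. -/
def DPairHom.mk' {P Q : DPair D} (a : P.X ⟶ Q.X) (b : P.Y ⟶ Q.Y)
    (comm : b ≫ Q.f = P.f ≫ a) : P ⟶ Q := ⟨a, b, comm⟩

@[simp] lemma DPairHom.comp_a {P Q R : DPair D} (φ : P ⟶ Q) (ψ : Q ⟶ R) :
    (φ ≫ ψ).a = φ.a ≫ ψ.a := rfl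
@[simp] lemma DPairHom.comp_b {P Q R : DPair D} (φ : P ⟶ Q) (ψ : Q ⟶ R) :
    (φ ≫ ψ).b = φ.b ≫ ψ.b := rfl
@[simp] lemma DPairHom.id_a (P : DPair D) : (𝟙 P : P ⟶ P).a = 𝟙 P.X := rfl
@[simp] lemma DPairHom.id_b (P : DPair D) : (𝟙 P : P ⟶ P).b = 𝟙 P.Y := rfl

/-- An initial object `0` such that `0 ⟶ X` is distinguished for every `X`. -/
structure InitialData (D : DistCat C) : Type (max u v) where
  O : C
  isInit : IsInitial O
  distTo : ∀ X : C, D.dist (isInit.to X)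

variable (ID : InitialData D)

/-- The pair `(X, 0)`. -/
def InitialData.ofObj (X : C) : DPair D := ⟨X, ID.O, ID.isInit.to X, ID.distTo X⟩

/-- The morphism of pairs `(X,0) ⟶ (X',0)` induced by `g : X ⟶ X'`. -/
def InitialData.ofMap {X X' : C} (g : X ⟶ X') : ID.ofObj X ⟶ ID.ofObj X' :=
  DPairHom.mk' g (𝟙 ID.O) (ID.isInit.hom_ext _ _)

/-- The morphism of pairs `(Y,0) ⟶ (X,0)` induced by a pair `(X,Y)`. -/
def InitialData.inclY (P : DPair D) : ID.ofObj P.Y ⟶ ID.ofObj P.X := ID.ofMap P.f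

/-- The morphism of pairs `(X,0) ⟶ (X,Y)`. -/
def InitialData.inclP (P : DPair D) : ID.ofObj P.X ⟶ P :=
  DPairHom.mk' (𝟙 P.X) (ID.isInit.to P.Y) (ID.isInit.hom_ext _ _)

/-- The morphism `(Y,0) ⟶ (Y',0)` induced on second components by a morphism of pairs. -/
def InitialData.mapY {P Q : DPair D} (φ : P ⟶ Q) : ID.ofObj P.Y ⟶ ID.ofObj Q.Y :=
  ID.ofMap φ.b

/-- Exactness of a composable pair of morphisms in an abelian category. -/
def ExactPair {A : Type w} [Category.{t} A] [Abelian A] {X Y Z : A}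
    (f : X ⟶ Y) (g : Y ⟶ Z) : Prop :=
  ∃ w : f ≫ g = 0, (ShortComplex.mk f g w).Exact

/-- A relative homology theory on the category of pairs: a family of functors
`H_i : 𝒞^□ ⥤ 𝒜` (`i ∈ ℤ`) together with connecting morphisms
`∂_i : H_i(X,Y) ⟶ H_{i-1}(Y)`, natural in the pair `(X,Y)`, such that the long
sequence `⋯ → H_i(Y) → H_i(X) → H_i(X,Y) → H_{i-1}(Y) → ⋯` is exact. -/
structure RelHomology (ID : InitialData D) (A : Type w) [Category.{t} A] [Abelian A] where
  H : ℤ → DPair D ⥤ A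
  δ : ∀ (i : ℤ) (P : DPair D), (H i).obj P ⟶ (H (i-1)).obj (ID.ofObj P.Y)
  δ_nat : ∀ (i : ℤ) {P Q : DPair D} (φ : P ⟶ Q),
    (H i).map φ ≫ δ i Q = δ i P ≫ (H (i-1)).map (ID.mapY φ)
  zero₁ : ∀ (i : ℤ) (P : DPair D), (H i).map (ID.inclY P) ≫ (H i).map (ID.inclP P) = 0
  zero₂ : ∀ (i : ℤ) (P : DPair D), (H i).map (ID.inclP P) ≫ δ i P = 0
  zero₃ : ∀ (i : ℤ) (P : DPair D), δ i P ≫ (H (i-1)).map (ID.inclY P) = 0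
  ex₁ : ∀ (i : ℤ) (P : DPair D), (ShortComplex.mk _ _ (zero₁ i P)).Exact
  ex₂ : ∀ (i : ℤ) (P : DPair D), (ShortComplex.mk _ _ (zero₂ i P)).Exact
  ex₃ : ∀ (i : ℤ) (P : DPair D), (ShortComplex.mk _ _ (zero₃ i P)).Exact

section MayerVietoris

variable {A : Type w} [Category.{t} A] [Abelian A] (RH : RelHomology ID A)

/-- First Mayer-Vietoris map `H_i(Z) ⟶ H_i(Y) ⊕ H_i(X)` for an excisive square
`ε : (Y,Z) ⟶ (W,X)`; it is induced by `Z ⟶ Y` and `Z ⟶ X`. -/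
noncomputable def mv₁ {P Q : DPair D} (ε : P ⟶ Q) (i : ℤ) :
    (RH.H i).obj (ID.ofObj P.Y) ⟶
      (RH.H i).obj (ID.ofObj P.X) ⊞ (RH.H i).obj (ID.ofObj Q.Y) :=
  biprod.lift ((RH.H i).map (ID.ofMap P.f)) ((RH.H i).map (ID.ofMap ε.b))

/-- Second Mayer-Vietoris map `H_i(Y) ⊕ H_i(X) ⟶ H_i(W)`, induced by `Y ⟶ W`
and (minus) `X ⟶ W`. -/
noncomputable def mv₂ {P Q : DPair D} (ε : P ⟶ Q) (i : ℤ) :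
    (RH.H i).obj (ID.ofObj P.X) ⊞ (RH.H i).obj (ID.ofObj Q.Y) ⟶
      (RH.H i).obj (ID.ofObj Q.X) :=
  biprod.desc ((RH.H i).map (ID.ofMap ε.a)) (-((RH.H i).map (ID.ofMap Q.f)))

/-- The Mayer-Vietoris connecting map `H_i(W) ⟶ H_{i-1}(Z)`: it is the composite
of the map `H_i(W) ⟶ H_i(W,X)`, the inverse of the excision isomorphism
`H_i(Y,Z) ≅ H_i(W,X)` and the connecting morphism `H_i(Y,Z) ⟶ H_{i-1}(Z)`. -/
noncomputable def mv₃ {P Q : DPair D} (ε : P ⟶ Q) (i : ℤ)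
    (h : IsIso ((RH.H i).map ε)) :
    (RH.H i).obj (ID.ofObj Q.X) ⟶ (RH.H (i-1)).obj (ID.ofObj P.Y) :=
  (RH.H i).map (ID.inclP Q) ≫ @inv _ _ _ _ _ h ≫ RH.δ i P

section Ladder

variable {A : Type w} [Category.{t} A] [Abelian A]

lemma ladder_exact₁ {E₁ X Y E E₁' X' Y' E' : A}
    {d : E₁ ⟶ X} {f : X ⟶ Y} {g : Y ⟶ E} {d' : E₁' ⟶ X'} {f' : X' ⟶ Y'} {g' : Y' ⟶ E'}
    (e₁ : E₁ ⟶ E₁') (α : X ⟶ X') (β : Y ⟶ Y') (e : E ⟶ E') [IsIso e₁] [IsIso e]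
    (wd : d ≫ f = 0) (hX : ExactPair d' f') (hY : ExactPair f g) (w' : f' ≫ g' = 0)
    (c₁ : e₁ ≫ d' = d ≫ α) (c₂ : α ≫ f' = f ≫ β) (c₃ : β ≫ g' = g ≫ e) :
    ExactPair (biprod.lift f α) (biprod.desc β (-f')) := by
  obtain ⟨_, hX⟩ := hX
  obtain ⟨_, hY⟩ := hY
  refine ⟨by simp [c₂], ?_⟩
  rw [ShortComplex.exact_iff_exact_up_to_refinements]
  intro T x hx
  dsimp at x hx
  have hx' : x ≫ biprod.fst ≫ β = x ≫ biprod.snd ≫ f' := by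
    have h0 : biprod.desc β (-f') = biprod.fst ≫ β + biprod.snd ≫ (-f') := biprod.desc_eq
    have hx₁ := hx.symm.trans (congrArg (fun z => x ≫ z) h0)
    simp only [Preadditive.comp_sub, Preadditive.comp_neg, ← sub_eq_add_neg] at hx₁
    exact sub_eq_zero.1 hx₁.symm
  have h1 : (x ≫ biprod.fst) ≫ g = 0 := by
    rw [← cancel_mono e, zero_comp, Category.assoc, ← c₃, Category.assoc,
      reassoc_of% hx', w']
    simp
  obtain ⟨T₁, π₁, _, a, ha⟩ := hY.exact_up_to_refinements _ h1
  dsimp at a ha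
  have h2 : (a ≫ α - π₁ ≫ x ≫ biprod.snd) ≫ f' = 0 := by
    simp only [Preadditive.sub_comp, Category.assoc, c₂]
    rw [← reassoc_of% ha, hx', sub_self]
  obtain ⟨T₂, π₂, _, y, hy⟩ := hX.exact_up_to_refinements _ h2
  dsimp at y hy
  refine ⟨T₂, π₂ ≫ π₁, inferInstance, π₂ ≫ a - y ≫ inv e₁ ≫ d, ?_⟩
  have h3 : inv e₁ ≫ d ≫ α = d' := by rw [← c₁]; simp
  apply biprod.hom_ext
  · simp [ha, wd]
  · simp only [Category.assoc, biprod.lift_snd, Preadditive.sub_comp, h3, ← hy,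
      Preadditive.comp_sub]
    simp

lemma ladder_exact₂ {Y E Z X' Y' E' : A}
    {g : Y ⟶ E} {d : E ⟶ Z} {f' : X' ⟶ Y'} {g' : Y' ⟶ E'}
    (β : Y ⟶ Y') (e : E ⟶ E') [IsIso e]
    (hE : ExactPair g d) (hY : ExactPair f' g')
    (c₃ : β ≫ g' = g ≫ e) :
    ExactPair (biprod.desc β (-f')) (g' ≫ inv e ≫ d) := by
  obtain ⟨w, hE⟩ := hE
  obtain ⟨w', hY⟩ := hY
  refine ⟨by ext <;> simp [reassoc_of% c₃, reassoc_of% w', w], ?_⟩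
  rw [ShortComplex.exact_iff_exact_up_to_refinements]
  intro T x hx
  dsimp at x hx
  obtain ⟨T₁, π₁, _, b, hb⟩ := hE.exact_up_to_refinements (x ≫ g' ≫ inv e) (by simpa using hx)
  dsimp at b hb
  have h2 : (b ≫ β - π₁ ≫ x) ≫ g' = 0 := by
    simp only [Preadditive.sub_comp, Category.assoc, c₃]
    rw [← reassoc_of% hb]
    simp
  obtain ⟨T₂, π₂, _, y, hy⟩ := hY.exact_up_to_refinements _ h2
  dsimp at y hy
  refine ⟨T₂, π₂ ≫ π₁, inferInstance, biprod.lift (π₂ ≫ b) y, ?_⟩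
  simp [← hy]

lemma ladder_exact₃ {E X Y Y' E' X' : A}
    {d : E ⟶ X} {f : X ⟶ Y} {g' : Y' ⟶ E'} {d' : E' ⟶ X'}
    (e : E ⟶ E') (α : X ⟶ X') [IsIso e]
    (hX : ExactPair d f) (hE : ExactPair g' d') (c₁ : e ≫ d' = d ≫ α) :
    ExactPair (g' ≫ inv e ≫ d) (biprod.lift f α) := by
  obtain ⟨w, hX⟩ := hX
  obtain ⟨w', hE⟩ := hE
  refine ⟨by ext <;> simp [← c₁, w', w], ?_⟩
  rw [ShortComplex.exact_iff_exact_up_to_refinements]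
  intro T x hx
  dsimp at x hx
  have hf : x ≫ f = 0 := by simpa using hx =≫ biprod.fst
  have hα : x ≫ α = 0 := by simpa using hx =≫ biprod.snd
  obtain ⟨T₁, π₁, _, b, hb⟩ := hX.exact_up_to_refinements _ hf
  dsimp at b hb
  have h2 : (b ≫ e) ≫ d' = 0 := by
    rw [Category.assoc, c₁, ← reassoc_of% hb, hα, comp_zero]
  obtain ⟨T₂, π₂, _, y, hy⟩ := hE.exact_up_to_refinements _ h2
  dsimp at y hy
  refine ⟨T₂, π₂ ≫ π₁, inferInstance, y, ?_⟩
  dsimp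
  rw [← reassoc_of% hy]
  simp [hb]

end Ladder

lemma InitialData.ofMap_comp {X Y Z : C} (f : X ⟶ Y) (g : Y ⟶ Z) :
    ID.ofMap f ≫ ID.ofMap g = ID.ofMap (f ≫ g) := by
  apply DPairHom.ext
  · rfl
  · exact ID.isInit.hom_ext _ _

lemma InitialData.inclP_nat {P Q : DPair D} (ε : P ⟶ Q) :
    ID.ofMap ε.a ≫ ID.inclP Q = ID.inclP P ≫ ε := by
  apply DPairHom.ext
  · exact (Category.comp_id _).trans (Category.id_comp _).symm
  · exact ID.isInit.hom_ext _ _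

/-- **Mayer-Vietoris sequence.** Let `𝒞` be a category with a distinguished
subcategory and an initial object `0` with `0 ⟶ X` distinguished, and let `H` be
a relative homology on `𝒞` with values in an abelian category `𝒜` satisfying
excision with respect to a collection `Ξ` of excisive squares.  Then every
excisive square `ε : (Y,Z) ⟶ (W,X)` gives rise to a long exact sequence
`⋯ → H_i(Z) → H_i(Y) ⊕ H_i(X) → H_i(W) → H_{i-1}(Z) → ⋯`, natural with respect
to morphisms of excisive squares. -/
theorem mayer_vietoris
    (Exc : ∀ ⦃P Q : DPair D⦄, (P ⟶ Q) → Prop)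
    -- `Ξ` contains all identity squares
    (exc_id : ∀ P : DPair D, Exc (𝟙 P))
    -- `Ξ` is stable under isomorphism of squares
    (exc_iso : ∀ ⦃P P' Q Q' : DPair D⦄ (e : P' ≅ P) (e' : Q ≅ Q') (ε : P ⟶ Q),
      Exc ε → Exc (e.hom ≫ ε ≫ e'.hom))
    -- excision axiom
    (hexc : ∀ ⦃P Q : DPair D⦄ (ε : P ⟶ Q), Exc ε → ∀ i : ℤ, IsIso ((RH.H i).map ε)) :
    ∀ ⦃P Q : DPair D⦄ (ε : P ⟶ Q) (hε : Exc ε),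
      -- long exact Mayer-Vietoris sequence
      (∀ i : ℤ,
        ExactPair (mv₁ ID RH ε i) (mv₂ ID RH ε i) ∧
        ExactPair (mv₂ ID RH ε i) (mv₃ ID RH ε i (hexc ε hε i)) ∧
        ExactPair (mv₃ ID RH ε i (hexc ε hε i)) (mv₁ ID RH ε (i-1))) ∧
      -- naturality with respect to morphisms of excisive squares
      (∀ ⦃P' Q' : DPair D⦄ (ε' : P' ⟶ Q') (hε' : Exc ε') (φ : P ⟶ P') (ψ : Q ⟶ Q'),
        ε ≫ ψ = φ ≫ ε' → ∀ i : ℤ,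
        ((RH.H i).map (ID.ofMap φ.b) ≫ mv₁ ID RH ε' i =
          mv₁ ID RH ε i ≫
            biprod.map ((RH.H i).map (ID.ofMap φ.a)) ((RH.H i).map (ID.ofMap ψ.b))) ∧
        (biprod.map ((RH.H i).map (ID.ofMap φ.a)) ((RH.H i).map (ID.ofMap ψ.b)) ≫
            mv₂ ID RH ε' i = mv₂ ID RH ε i ≫ (RH.H i).map (ID.ofMap ψ.a)) ∧
        ((RH.H i).map (ID.ofMap ψ.a) ≫ mv₃ ID RH ε' i (hexc ε' hε' i) =
          mv₃ ID RH ε i (hexc ε hε i) ≫ (RH.H (i-1)).map (ID.ofMap φ.b))) := by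
  intro P Q ε hε
  have nat₁ : ∀ (i : ℤ) {P Q : DPair D} (ε : P ⟶ Q),
      (RH.H i).map (ID.ofMap ε.b) ≫ (RH.H i).map (ID.ofMap Q.f) =
        (RH.H i).map (ID.ofMap P.f) ≫ (RH.H i).map (ID.ofMap ε.a) := by
    intro i P Q ε
    rw [← Functor.map_comp, ← Functor.map_comp, ID.ofMap_comp, ID.ofMap_comp, ε.comm]
  have nat₂ : ∀ (i : ℤ) {P Q : DPair D} (ε : P ⟶ Q),
      (RH.H i).map (ID.ofMap ε.a) ≫ (RH.H i).map (ID.inclP Q) =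
        (RH.H i).map (ID.inclP P) ≫ (RH.H i).map ε := by
    intro i P Q ε
    rw [← Functor.map_comp, ← Functor.map_comp, ID.inclP_nat]
  have E₁ : ∀ j : ℤ, ExactPair (mv₁ ID RH ε (j-1)) (mv₂ ID RH ε (j-1)) := by
    intro j
    have := hexc ε hε j
    have := hexc ε hε (j-1)
    exact ladder_exact₁ ((RH.H j).map ε) _ _ ((RH.H (j-1)).map ε) (RH.zero₃ j P)
      ⟨_, RH.ex₃ j Q⟩ ⟨_, RH.ex₁ (j-1) P⟩ (RH.zero₁ (j-1) Q) (RH.δ_nat j ε)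
      (nat₁ _ ε) (nat₂ _ ε)
  refine ⟨fun i => ⟨?_, ?_, ?_⟩, ?_⟩
  · obtain ⟨j, rfl⟩ : ∃ j : ℤ, i = j - 1 := ⟨i + 1, by simp⟩
    exact E₁ j
  · have := hexc ε hε i
    exact ladder_exact₂ _ ((RH.H i).map ε) ⟨_, RH.ex₂ i P⟩ ⟨_, RH.ex₁ i Q⟩ (nat₂ _ ε)
  · have := hexc ε hε i
    exact ladder_exact₃ ((RH.H i).map ε) _ ⟨_, RH.ex₃ i P⟩ ⟨_, RH.ex₂ i Q⟩ (RH.δ_nat i ε)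
  · intro P' Q' ε' hε' φ ψ h i
    have ha : ε.a ≫ ψ.a = φ.a ≫ ε'.a := congrArg DPairHom.a h
    have hb : ε.b ≫ ψ.b = φ.b ≫ ε'.b := congrArg DPairHom.b h
    have hb' : (RH.H i).map (ID.ofMap φ.b) ≫ (RH.H i).map (ID.ofMap ε'.b) =
        (RH.H i).map (ID.ofMap ε.b) ≫ (RH.H i).map (ID.ofMap ψ.b) := by
      rw [← Functor.map_comp, ← Functor.map_comp, ID.ofMap_comp, ID.ofMap_comp, hb]
    have ha' : (RH.H i).map (ID.ofMap φ.a) ≫ (RH.H i).map (ID.ofMap ε'.a) =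
        (RH.H i).map (ID.ofMap ε.a) ≫ (RH.H i).map (ID.ofMap ψ.a) := by
      rw [← Functor.map_comp, ← Functor.map_comp, ID.ofMap_comp, ID.ofMap_comp, ha]
    refine ⟨?_, ?_, ?_⟩
    · unfold mv₁
      apply biprod.hom_ext
      · simpa using nat₁ i φ
      · simpa using hb'
    · unfold mv₂
      apply biprod.hom_ext'
      · simpa using ha'
      · simpa using nat₁ i ψ
    · unfold mv₃
      have := hexc ε hε i
      have := hexc ε' hε' i
      have h1 : (RH.H i).map ψ ≫ inv ((RH.H i).map ε') =
          inv ((RH.H i).map ε) ≫ (RH.H i).map φ := by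
        rw [IsIso.comp_inv_eq, Category.assoc, IsIso.eq_inv_comp, ← Functor.map_comp,
          ← Functor.map_comp, h]
      have h2 := RH.δ_nat i φ
      rw [reassoc_of% (nat₂ i ψ), reassoc_of% h1, h2]
      simp only [Category.assoc]
      rfl

end MayerVietoris
end

section
/- Let 𝒞 have finite coproducts such that the canonical morphisms into a coproduct are distinguished, and let H be a relative homology on 𝒞 with values in an abelian category 𝒜. Then for any two objects X, Y of 𝒞, the morphism of pairs κ : (Y,0) → (X ⊔ Y, X) induces isomorphisms κ_i : H_i(Y) ≅ H_i(X ⊔ Y, X) for all i ∈ ℤ if and only if the canonical morphism γ_i : H_i(X) ⊕ H_i(Y) → H_i(X ⊔ Y) induced by the coproduct injections is an isomorphism for all i ∈ ℤ. In other words, the category of pairs has excisive coproducts for a relative homology if and only if the relative homology is finitely additive. -/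
open CategoryTheory Limits

universe u v w t

variable {C : Type u} [Category.{v} C]

variable {D : DistCat C}

variable (ID : InitialData D)

section Additivity

variable {A : Type w} [Category.{t} A] [Abelian A]

lemma desc_isIso {S T U V : A} (a : S ⟶ T) (b : V ⟶ T) (p : T ⟶ U) (w : a ≫ p = 0)
    (ex : (ShortComplex.mk a p w).Exact) (ha : Mono a) (hp : Epi p) (h : IsIso (b ≫ p)) :
    IsIso (biprod.desc a b) := by
  have : Mono (biprod.desc a b) := by
    refine Preadditive.mono_of_cancel_zero _ fun u hu => ?_
    rw [biprod.desc_eq, Preadditive.comp_add] at hu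
    have h2 : u ≫ biprod.snd = 0 := by
      rw [← cancel_mono (b ≫ p)]
      have := congrArg (· ≫ p) hu
      simpa [w] using this
    have h1 : u ≫ biprod.fst = 0 := by
      rw [← cancel_mono a]
      simpa [reassoc_of% h2] using hu
    ext <;> simp [h1, h2]
  have : Epi (biprod.desc a b) := by
    refine Preadditive.epi_of_cancel_zero _ fun {Z} t ht => ?_
    have hat : a ≫ t = 0 := by simpa using congrArg (biprod.inl ≫ ·) ht
    have hbt : b ≫ t = 0 := by simpa using congrArg (biprod.inr ≫ ·) ht
    have : Epi (ShortComplex.mk a p w).g := hp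
    obtain ⟨s, hs⟩ : ∃ s : U ⟶ Z, p ≫ s = t := ⟨ex.desc t hat, ex.g_desc t hat⟩
    have : s = 0 := by
      rw [← cancel_epi (b ≫ p), Category.assoc, hs, hbt, comp_zero]
    rw [← hs, this, comp_zero]
  exact isIso_of_mono_of_epi _

lemma comp_isIso_of_desc {S T U V : A} (a : S ⟶ T) (b : V ⟶ T) (p : T ⟶ U) (w : a ≫ p = 0)
    (ex : (ShortComplex.mk a p w).Exact) (ha : Mono a) (hp : Epi p)
    (h : IsIso (biprod.desc a b)) : IsIso (b ≫ p) := by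
  have : Mono (b ≫ p) := by
    refine Preadditive.mono_of_cancel_zero _ fun {Z} u hu => ?_
    rw [← Category.assoc] at hu
    have : Mono (ShortComplex.mk a p w).f := ha
    obtain ⟨s, hs⟩ : ∃ s : Z ⟶ S, s ≫ a = u ≫ b := ⟨ex.lift _ hu, ex.lift_f _ hu⟩
    have : biprod.lift s (-u) = 0 := by
      rw [← cancel_mono (biprod.desc a b)]
      simp [hs]
    simpa using congrArg (· ≫ biprod.snd) this
  have : Epi (b ≫ p) := by
    refine Preadditive.epi_of_cancel_zero _ fun {Z} s hs => ?_
    rw [← cancel_epi p, ← cancel_epi (biprod.desc a b)]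
    ext
    · simp [reassoc_of% w]
    · simpa using hs
  exact isIso_of_mono_of_epi _

/-- **Excisive coproducts ⟺ additivity.**  Let `𝒞` have finite coproducts whose
canonical injections are distinguished, and let `H` be a relative homology on `𝒞`
with values in an abelian category.  For any `X, Y`, the morphism of pairs
`κ : (Y,0) ⟶ (X ⨿ Y, X)` induces isomorphisms `H_i(Y) ≅ H_i(X ⨿ Y, X)` for all
`i ∈ ℤ` if and only if the canonical morphism `H_i(X) ⊕ H_i(Y) ⟶ H_i(X ⨿ Y)`
induced by the coproduct injections is an isomorphism for all `i ∈ ℤ`. -/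
theorem excisive_coproducts_iff_additive [HasBinaryCoproducts C]
    (hinl : ∀ X Y : C, D.dist (coprod.inl : X ⟶ X ⨿ Y))
    (hinr : ∀ X Y : C, D.dist (coprod.inr : Y ⟶ X ⨿ Y))
    (RH : RelHomology ID A) (X Y : C) :
    (∀ i : ℤ, IsIso ((RH.H i).map
      (DPairHom.mk' (P := ID.ofObj Y) (Q := ⟨X ⨿ Y, X, coprod.inl, hinl X Y⟩)
        coprod.inr (ID.isInit.to X) (ID.isInit.hom_ext _ _)))) ↔
    (∀ i : ℤ, IsIso (biprod.desc
      ((RH.H i).map (ID.ofMap (coprod.inl : X ⟶ X ⨿ Y)))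
      ((RH.H i).map (ID.ofMap (coprod.inr : Y ⟶ X ⨿ Y))))) := by
  set P : DPair D := ⟨X ⨿ Y, X, coprod.inl, hinl X Y⟩ with hP
  set κ : ID.ofObj Y ⟶ P := DPairHom.mk' (P := ID.ofObj Y) (Q := P)
        coprod.inr (ID.isInit.to X) (ID.isInit.hom_ext _ _) with hκ
  have hκp : κ = ID.ofMap (coprod.inr : Y ⟶ X ⨿ Y) ≫ ID.inclP P := by
    apply DPairHom.ext
    · exact (Category.comp_id _).symm
    · exact ID.isInit.hom_ext _ _
  have hk : ∀ i, (RH.H i).map κ =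
      (RH.H i).map (ID.ofMap (coprod.inr : Y ⟶ X ⨿ Y)) ≫ (RH.H i).map (ID.inclP P) := by
    intro i
    rw [hκp]
    exact (RH.H i).map_comp _ _
  clear_value κ
  constructor
  · intro h
    have hp : ∀ i, Epi ((RH.H i).map (ID.inclP P)) := by
      intro i
      have := h i
      rw [hk i] at this
      exact epi_of_epi ((RH.H i).map (ID.ofMap (coprod.inr : Y ⟶ X ⨿ Y))) _
    have ha' : ∀ i j : ℤ, j = i - 1 → Mono ((RH.H j).map (ID.inclY P)) := by
      rintro i j rfl
      have := hp i
      refine (RH.ex₃ i P).mono_g ?_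
      exact (cancel_epi ((RH.H i).map (ID.inclP P))).1 ((RH.zero₂ i P).trans comp_zero.symm)
    intro i
    have ha := ha' (i + 1) i (by ring)
    have hpi := hp i
    have hi := h i
    refine desc_isIso _ _ _ (RH.zero₁ i P) (RH.ex₁ i P) ha hpi ?_
    rw [← hk i]; exact hi
  · intro h
    have ha : ∀ i, Mono ((RH.H i).map (ID.inclY P)) := by
      intro i
      have := h i
      have e : (RH.H i).map (ID.inclY P) = biprod.inl ≫ (biprod.desc
        ((RH.H i).map (ID.ofMap (coprod.inl : X ⟶ X ⨿ Y)))
        ((RH.H i).map (ID.ofMap (coprod.inr : Y ⟶ X ⨿ Y)))) := (biprod.inl_desc _ _).symm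
      rw [e]
      exact mono_comp _ _
    intro i
    have hpi : Epi ((RH.H i).map (ID.inclP P)) := by
      have := ha (i - 1)
      refine (RH.ex₂ i P).epi_f ?_
      exact (cancel_mono ((RH.H (i-1)).map (ID.inclY P))).1
        ((RH.zero₃ i P).trans zero_comp.symm)
    rw [hk i]
    exact comp_isIso_of_desc _ _ _ (RH.zero₁ i P) (RH.ex₁ i P) (ha i) hpi (h i)

end Additivity
end
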